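/- arXiv:1505.08169 — 2 statements merged into one kernel-verified Lean document; each statement's English description precedes it below -/
import Mathlib

section
/- Under the stated setup, for every height profile 𝐡 : K → ℝ, every subset S ⊆ K, every configuration ω : K → Bool, every x ∈ S, and every Borel measurable increasing set U ⊆ (K → ℝ) (i.e. φ ∈ U and φ ≤ ψ pointwise imply ψ ∈ U), one has μ(U ∩ C_ω) · μ(C_{ω^x}) ≤ μ(U ∩ C_{ω^x}) · μ(C_ω), where C_ω := {φ : K → ℝ | ∀ z ∈ S, (𝐡 z ≤ φ z ↔ ω z = true)} and ω^x denotes ω with its value at x replaced by true. (This is the conditional stochastic domination of Lemma 2.4: conditionally on the level-set configuration on S, opening one more site raises the field stochastically.) -/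
open MeasureTheory Real

open scoped ENNReal

theorem ENNReal.add_le_add_of_mul_le_mul {a b c d : ℝ≥0∞} (hac : a ≤ c) (hbc : b ≤ c)
    (h : a * b ≤ c * d) : a + b ≤ c + d := by
  rcases eq_or_ne c ∞ with rfl | hc
  · simp
  rcases eq_or_ne d ∞ with rfl | hd
  · simp
  lift c to NNReal using hc
  lift d to NNReal using hd
  lift a to NNReal using ne_top_of_le_ne_top coe_ne_top hac
  lift b to NNReal using ne_top_of_le_ne_top coe_ne_top hbc
  norm_cast at *
  rcases eq_or_ne c 0 with rfl | hc0
  · simp [le_zero_iff.mp hac, le_zero_iff.mp hbc]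
  have hc' : (0 : ℝ) < c := by exact_mod_cast pos_iff_ne_zero.mpr hc0
  rw [← NNReal.coe_le_coe] at *
  push_cast at *
  refine le_of_mul_le_mul_left ?_ hc'
  nlinarith [mul_nonneg (sub_nonneg.mpr hac) (sub_nonneg.mpr hbc)]

/-- The **four functions theorem** for a measure on a linear order. -/
theorem MeasureTheory.lintegral_mul_lintegral_le_of_sup_inf {α : Type*} [LinearOrder α]
    [MeasurableSpace α] {ν : Measure α} {f₁ f₂ f₃ f₄ : α → ℝ≥0∞}
    (h₁ : Measurable f₁) (h₂ : Measurable f₂) (h₃ : Measurable f₃) (h₄ : Measurable f₄)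
    (h : ∀ a b, f₁ a * f₂ b ≤ f₃ (a ⊔ b) * f₄ (a ⊓ b)) :
    (∫⁻ a, f₁ a ∂ν) * ∫⁻ a, f₂ a ∂ν ≤ (∫⁻ a, f₃ a ∂ν) * ∫⁻ a, f₄ a ∂ν := by
  have key : ∀ {f g : α → ℝ≥0∞}, Measurable f → Measurable g →
      ∫⁻ a, ∫⁻ b, (f a * g b + f b * g a) ∂ν ∂ν =
        2 * ((∫⁻ a, f a ∂ν) * ∫⁻ a, g a ∂ν) := by
    intro f g hf hg
    have inner (a : α) : ∫⁻ b, (f a * g b + f b * g a) ∂ν =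
        f a * ∫⁻ b, g b ∂ν + (∫⁻ b, f b ∂ν) * g a := by
      rw [lintegral_add_left (hg.const_mul _), lintegral_const_mul _ hg, lintegral_mul_const _ hf]
    simp_rw [inner]
    rw [lintegral_add_left (hf.mul_const _), lintegral_mul_const _ hf, lintegral_const_mul _ hg,
      two_mul]
  have pointwise : ∀ a b, b ≤ a →
      f₁ a * f₂ b + f₁ b * f₂ a ≤ f₃ a * f₄ b + f₃ b * f₄ a := by
    intro a b hab
    refine ENNReal.add_le_add_of_mul_le_mul ?_ ?_ ?_
    · simpa [hab] using h a b
    · simpa [hab] using h b a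
    · calc f₁ a * f₂ b * (f₁ b * f₂ a) = f₁ a * f₂ a * (f₁ b * f₂ b) := by ring
        _ ≤ f₃ a * f₄ a * (f₃ b * f₄ b) :=
          mul_le_mul' (by simpa using h a a) (by simpa using h b b)
        _ = f₃ a * f₄ b * (f₃ b * f₄ a) := by ring
  have sym : ∀ a b, f₁ a * f₂ b + f₁ b * f₂ a ≤ f₃ a * f₄ b + f₃ b * f₄ a := by
    intro a b
    rcases le_total b a with hab | hab
    · exact pointwise a b hab
    · simpa only [add_comm] using pointwise b a hab
  have hle : 2 * ((∫⁻ a, f₁ a ∂ν) * ∫⁻ a, f₂ a ∂ν) ≤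
      2 * ((∫⁻ a, f₃ a ∂ν) * ∫⁻ a, f₄ a ∂ν) := by
    rw [← key h₁ h₂, ← key h₃ h₄]
    exact lintegral_mono fun a => lintegral_mono fun b => sym a b
  exact (ENNReal.mul_le_mul_iff_right two_ne_zero ENNReal.ofNat_ne_top).mp hle

/-- The **four functions theorem** for marginals of a product measure on a finite product of linear
orders. -/
theorem MeasureTheory.lmarginal_mul_lmarginal_le_of_sup_inf {ι : Type*} [DecidableEq ι]
    {X : ι → Type*} [∀ i, LinearOrder (X i)] [∀ i, MeasurableSpace (X i)]
    {ν : ∀ i, Measure (X i)} [∀ i, SigmaFinite (ν i)] {f₁ f₂ f₃ f₄ : (∀ i, X i) → ℝ≥0∞}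
    (h₁ : Measurable f₁) (h₂ : Measurable f₂) (h₃ : Measurable f₃) (h₄ : Measurable f₄)
    (h : ∀ x y, f₁ x * f₂ y ≤ f₃ (x ⊔ y) * f₄ (x ⊓ y)) (s : Finset ι) (x y : ∀ i, X i) :
    lmarginal ν s f₁ x * lmarginal ν s f₂ y ≤
      lmarginal ν s f₃ (x ⊔ y) * lmarginal ν s f₄ (x ⊓ y) := by
  induction s using Finset.induction_on generalizing x y with
  | empty => simpa using h x y
  | insert i s hi ih =>
    have meas {f : (∀ i, X i) → ℝ≥0∞} (hf : Measurable f) (z : ∀ i, X i) :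
        Measurable fun a => lmarginal ν s f (Function.update z i a) :=
      (hf.lmarginal ν).comp (measurable_update z)
    rw [lmarginal_insert _ h₁ hi, lmarginal_insert _ h₂ hi, lmarginal_insert _ h₃ hi,
      lmarginal_insert _ h₄ hi]
    refine lintegral_mul_lintegral_le_of_sup_inf (meas h₁ _) (meas h₂ _) (meas h₃ _) (meas h₄ _)
      fun a b => ?_
    have hsup : Function.update (x ⊔ y) i (a ⊔ b) =
        Function.update x i a ⊔ Function.update y i b := by
      ext j
      rcases eq_or_ne j i with rfl | hj <;> simp [*]
    have hinf : Function.update (x ⊓ y) i (a ⊓ b) =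
        Function.update x i a ⊓ Function.update y i b := by
      ext j
      rcases eq_or_ne j i with rfl | hj <;> simp [*]
    rw [hsup, hinf]
    exact ih _ _

/-- The **four functions theorem** for a product measure on a finite product of linear orders. -/
theorem MeasureTheory.lintegral_pi_mul_lintegral_pi_le_of_sup_inf {ι : Type*} [Fintype ι]
    {X : ι → Type*} [∀ i, LinearOrder (X i)] [∀ i, MeasurableSpace (X i)]
    {ν : ∀ i, Measure (X i)} [∀ i, SigmaFinite (ν i)] {f₁ f₂ f₃ f₄ : (∀ i, X i) → ℝ≥0∞}
    (h₁ : Measurable f₁) (h₂ : Measurable f₂) (h₃ : Measurable f₃) (h₄ : Measurable f₄)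
    (h : ∀ x y, f₁ x * f₂ y ≤ f₃ (x ⊔ y) * f₄ (x ⊓ y)) :
    (∫⁻ x, f₁ x ∂Measure.pi ν) * ∫⁻ x, f₂ x ∂Measure.pi ν ≤
      (∫⁻ x, f₃ x ∂Measure.pi ν) * ∫⁻ x, f₄ x ∂Measure.pi ν := by
  classical
  rcases isEmpty_or_nonempty (∀ i, X i) with hX | ⟨⟨z⟩⟩
  · simp
  · simpa [lmarginal_univ] using
      lmarginal_mul_lmarginal_le_of_sup_inf (ν := ν) h₁ h₂ h₃ h₄ h Finset.univ z z

theorem sq_sup_sub_sup_add_sq_inf_sub_inf_le (a b a' b' : ℝ) :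
    (b ⊔ b' - a ⊔ a') ^ 2 + (b ⊓ b' - a ⊓ a') ^ 2 ≤ (b - a) ^ 2 + (b' - a') ^ 2 := by
  rcases le_total a a' with h | h <;> rcases le_total b b' with h' | h' <;>
    simp only [sup_of_le_left, sup_of_le_right, inf_of_le_left, inf_of_le_right, h, h'] <;>
    nlinarith [mul_nonneg (sub_nonneg.mpr h) (sub_nonneg.mpr h')]

theorem sq_sup_add_sq_inf (a b : ℝ) : (a ⊔ b) ^ 2 + (a ⊓ b) ^ 2 = a ^ 2 + b ^ 2 := by
  rcases le_total a b with h | h <;> simp [h, add_comm]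

/-- The energy of a ferromagnetic Gaussian field is submodular. -/
theorem energy_sup_add_energy_inf_le {K : Type*} [Fintype K] {c : K → K → ℝ}
    (hpos : ∀ x y, 0 ≤ c x y) (κ : K → ℝ) {E : (K → ℝ) → ℝ}
    (hE : ∀ φ : K → ℝ,
      E φ = (1 / 2) * ∑ x, ∑ y, c x y * (φ y - φ x) ^ 2 + ∑ x, κ x * (φ x) ^ 2)
    (φ ψ : K → ℝ) : E (φ ⊔ ψ) + E (φ ⊓ ψ) ≤ E φ + E ψ := by
  have hc : ∑ x, ∑ y, c x y * ((φ ⊔ ψ) y - (φ ⊔ ψ) x) ^ 2 +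
      ∑ x, ∑ y, c x y * ((φ ⊓ ψ) y - (φ ⊓ ψ) x) ^ 2 ≤
      ∑ x, ∑ y, c x y * (φ y - φ x) ^ 2 + ∑ x, ∑ y, c x y * (ψ y - ψ x) ^ 2 := by
    simp only [← Finset.sum_add_distrib, ← mul_add]
    exact Finset.sum_le_sum fun x _ => Finset.sum_le_sum fun y _ => mul_le_mul_of_nonneg_left
      (sq_sup_sub_sup_add_sq_inf_sub_inf_le _ _ _ _) (hpos x y)
  have hκ : ∑ x, κ x * ((φ ⊔ ψ) x) ^ 2 + ∑ x, κ x * ((φ ⊓ ψ) x) ^ 2 =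
      ∑ x, κ x * (φ x) ^ 2 + ∑ x, κ x * (ψ x) ^ 2 := by
    simp only [← Finset.sum_add_distrib, ← mul_add, Pi.sup_apply, Pi.inf_apply, sq_sup_add_sq_inf]
  rw [hE, hE, hE, hE]
  linarith

/-- Sets of configurations with prescribed level set on `S` are measurable. -/
theorem measurableSet_levelSet_eq {K : Type*} [Finite K] (h : K → ℝ) (S : Set K) (ω : K → Bool) :
    MeasurableSet {φ : K → ℝ | ∀ z ∈ S, (h z ≤ φ z ↔ ω z = true)} := by
  have (z : K) : MeasurableSet {φ : K → ℝ | h z ≤ φ z} :=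
    measurableSet_le measurable_const (measurable_pi_apply z)
  simp only [Set.ofPred_forall]
  exact MeasurableSet.iInter fun z => MeasurableSet.iInter fun _ =>
    (this z).iff (MeasurableSet.const _)

/-- **Conditional stochastic domination** (Lemma 2.4): conditionally on the level-set
configuration on `S`, opening one more site raises the field stochastically: for every
increasing Borel set `U`, `μ(U ∩ C_ω) · μ(C_{ω^x}) ≤ μ(U ∩ C_{ω^x}) · μ(C_ω)`. -/
theorem conditional_stochastic_domination
    (K : Type) [Fintype K] [Nonempty K] [DecidableEq K]
    (c : K → K → ℝ) (hsym : ∀ x y, c x y = c y x) (hpos : ∀ x y, 0 ≤ c x y)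
    (κ : K → ℝ) (hκ : ∀ x, 0 < κ x)
    (E : (K → ℝ) → ℝ)
    (hE : ∀ φ : K → ℝ,
      E φ = (1 / 2) * ∑ x, ∑ y, c x y * (φ y - φ x) ^ 2 + ∑ x, κ x * (φ x) ^ 2)
    (Z : ℝ) (hZ : Z = ∫ φ : K → ℝ, Real.exp (-(E φ) / 2))
    (μ : Measure (K → ℝ))
    (hμ : μ = volume.withDensity fun φ => ENNReal.ofReal (Real.exp (-(E φ) / 2) / Z))
    (hprof : K → ℝ) (S : Set K) (ω : K → Bool) (x : K) (hx : x ∈ S)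
    (U : Set (K → ℝ)) (hUmeas : MeasurableSet U)
    (hUincr : ∀ φ ψ : K → ℝ, φ ∈ U → (∀ z, φ z ≤ ψ z) → ψ ∈ U)
    (Cω Cωx : Set (K → ℝ))
    (hCω : Cω = {φ : K → ℝ | ∀ z ∈ S, (hprof z ≤ φ z ↔ ω z = true)})
    (hCωx : Cωx =
      {φ : K → ℝ | ∀ z ∈ S, (hprof z ≤ φ z ↔ (Function.update ω x true) z = true)}) :
    μ (U ∩ Cω) * μ Cωx ≤ μ (U ∩ Cωx) * μ Cω := by
  have hle (z : K) : ω z = true → Function.update ω x true z = true := by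
    intro hz
    rcases eq_or_ne z x with rfl | hzx
    · simp
    · simpa [hzx] using hz
  have hCm : MeasurableSet Cω := hCω ▸ measurableSet_levelSet_eq hprof S ω
  have hCxm : MeasurableSet Cωx := hCωx ▸ measurableSet_levelSet_eq hprof S _
  have hsup {φ ψ : K → ℝ} (hφ : φ ∈ Cω) (hψ : ψ ∈ Cωx) : φ ⊔ ψ ∈ Cωx := by
    subst hCω hCωx
    intro z hz
    rw [Pi.sup_apply, le_sup_iff, hφ z hz, hψ z hz, or_iff_right_of_imp (hle z)]
  have hinf {φ ψ : K → ℝ} (hφ : φ ∈ Cω) (hψ : ψ ∈ Cωx) : φ ⊓ ψ ∈ Cω := by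
    subst hCω hCωx
    intro z hz
    rw [Pi.inf_apply, le_inf_iff, hφ z hz, hψ z hz, and_iff_left_of_imp (hle z)]
  have hEm : Measurable E := by
    rw [funext hE]
    fun_prop
  set g : (K → ℝ) → ℝ≥0∞ := fun φ => ENNReal.ofReal (Real.exp (-(E φ) / 2) / Z) with hg
  have hgm : Measurable g := by fun_prop
  have hZ0 : 0 ≤ Z := hZ ▸ integral_nonneg fun φ => (Real.exp_pos _).le
  have hglat (φ ψ : K → ℝ) : g φ * g ψ ≤ g (φ ⊔ ψ) * g (φ ⊓ ψ) := by
    simp only [hg]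
    rw [← ENNReal.ofReal_mul (by positivity), ← ENNReal.ofReal_mul (by positivity),
      div_mul_div_comm, div_mul_div_comm, ← Real.exp_add, ← Real.exp_add]
    gcongr ENNReal.ofReal (Real.exp ?_ / _)
    linarith [energy_sup_add_energy_inf_le hpos κ hE φ ψ]
  have hμA {A : Set (K → ℝ)} (hA : MeasurableSet A) : μ A = ∫⁻ φ, A.indicator g φ := by
    rw [hμ, withDensity_apply _ hA, lintegral_indicator hA]
  rw [hμA (hUmeas.inter hCm), hμA hCxm, hμA (hUmeas.inter hCxm), hμA hCm]
  refine lintegral_pi_mul_lintegral_pi_le_of_sup_inf (hgm.indicator (hUmeas.inter hCm))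
    (hgm.indicator hCxm) (hgm.indicator (hUmeas.inter hCxm)) (hgm.indicator hCm) fun φ ψ => ?_
  by_cases hφ : φ ∈ U ∩ Cω
  · by_cases hψ : ψ ∈ Cωx
    · have hU : φ ⊔ ψ ∈ U ∩ Cωx := ⟨hUincr φ _ hφ.1 fun _ => le_sup_left, hsup hφ.2 hψ⟩
      rw [Set.indicator_of_mem hφ, Set.indicator_of_mem hψ, Set.indicator_of_mem hU,
        Set.indicator_of_mem (hinf hφ.2 hψ)]
      exact hglat φ ψ
    · simp [hψ]
  · simp [hφ]
end

section
/- For every θ ∈ (0,1), M > 0, and 0 < v₀ ≤ v₁, there exists a constant c > 0, depending only on θ, M, v₀, v₁, with the following property. For every nonempty finite type K, every symmetric c : K → K → ℝ with c x y ≥ 0, every κ : K → ℝ with κ x ≥ θ for all x, the associated ferromagnetic Gaussian Gibbs measure μ, every x ∈ K such that v₀ ≤ ∫ (φ x)² dμ(φ) ≤ v₁, every increasing set A ⊆ (K → Bool), and every h ∈ (−M, M): ∫_{A^h} κ x · φ x dμ(φ) ≥ c · I_μ(A^h, x). (Pointwise domination of the conditional influence, Proposition 4.3, equation (4.7).) 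-/
open MeasureTheory Real

/-- The level-set event `A^h = {φ | (1{h ≤ φ x})_x ∈ A}`. -/
def levSet {K : Type} (A : Set (K → Bool)) (h : ℝ) : Set (K → ℝ) :=
  {φ | (fun x => decide (h ≤ φ x)) ∈ A}

/-- The conditional influence `I_μ(A^h, x)`. -/
noncomputable def condInfl {K : Type} (μ : Measure (K → ℝ))
    (A : Set (K → Bool)) (h : ℝ) (x : K) : ℝ :=
  (μ (levSet A h ∩ {φ | h ≤ φ x})).toReal / (μ {φ : K → ℝ | h ≤ φ x}).toReal
    - (μ (levSet A h ∩ {φ | φ x < h})).toReal / (μ {φ : K → ℝ | φ x < h}).toReal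

/-- The energy of the Gaussian network with conductances `c` and killing `κ`. -/
noncomputable def gibbsEnergy {K : Type} [Fintype K] (c : K → K → ℝ) (κ : K → ℝ) (φ : K → ℝ) : ℝ :=
  (1 / 2) * ∑ x, ∑ y, c x y * (φ y - φ x) ^ 2 + ∑ x, κ x * (φ x) ^ 2

/-- The operator `-Δ + κ` of the network, so that `gibbsEnergy c κ φ = ⟨φ, (-Δ + κ) φ⟩`. -/
noncomputable def massiveLaplacian {K : Type} [Fintype K] (c : K → K → ℝ) (κ : K → ℝ) :
    (K → ℝ) →ₗ[ℝ] (K → ℝ) where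
  toFun φ y := κ y * φ y + ∑ z, c y z * (φ y - φ z)
  map_add' φ ψ := by
    ext y
    simp only [Pi.add_apply]
    rw [show κ y * φ y + ∑ z, c y z * (φ y - φ z) + (κ y * ψ y + ∑ z, c y z * (ψ y - ψ z))
      = (κ y * φ y + κ y * ψ y) + (∑ z, c y z * (φ y - φ z) + ∑ z, c y z * (ψ y - ψ z)) by ring,
      ← Finset.sum_add_distrib]
    congr 1
    · ring
    · exact Finset.sum_congr rfl fun z _ => by ring
  map_smul' a φ := by
    ext y
    simp only [Pi.smul_apply, smul_eq_mul, RingHom.id_apply, mul_add, Finset.mul_sum]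
    congr 1
    · ring
    · exact Finset.sum_congr rfl fun z _ => by ring

section Energy

variable {K : Type} [Fintype K] {c : K → K → ℝ} {κ : K → ℝ}

lemma massiveLaplacian_apply (φ : K → ℝ) (y : K) :
    massiveLaplacian c κ φ y = κ y * φ y + ∑ z, c y z * (φ y - φ z) := rfl

lemma sum_mul_massiveLaplacian (hc : ∀ x y, c x y = c y x) (φ ψ : K → ℝ) :
    ∑ y, φ y * massiveLaplacian c κ ψ y =
      (1 / 2) * ∑ x, ∑ y, c x y * ((φ y - φ x) * (ψ y - ψ x)) + ∑ x, κ x * (φ x * ψ x) := by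
  have h₁ : ∑ y, φ y * massiveLaplacian c κ ψ y =
      ∑ y, ∑ z, φ y * (c y z * (ψ y - ψ z)) + ∑ x, κ x * (φ x * ψ x) := by
    rw [← Finset.sum_add_distrib]
    refine Finset.sum_congr rfl fun y _ => ?_
    rw [massiveLaplacian_apply, mul_add, Finset.mul_sum]
    ring
  have h₂ : ∑ y, ∑ z, φ y * (c y z * (ψ y - ψ z)) = ∑ y, ∑ z, φ z * (c y z * (ψ z - ψ y)) := by
    rw [Finset.sum_comm]
    refine Finset.sum_congr rfl fun y _ => Finset.sum_congr rfl fun z _ => ?_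
    rw [hc]
  have h₃ : ∑ x, ∑ y, c x y * ((φ y - φ x) * (ψ y - ψ x)) =
      ∑ y, ∑ z, φ y * (c y z * (ψ y - ψ z)) + ∑ y, ∑ z, φ z * (c y z * (ψ z - ψ y)) := by
    simp only [← Finset.sum_add_distrib]
    refine Finset.sum_congr rfl fun y _ => Finset.sum_congr rfl fun z _ => ?_
    ring
  rw [h₁, h₃, ← h₂]
  ring

lemma gibbsEnergy_eq_sum (hc : ∀ x y, c x y = c y x) (φ : K → ℝ) :
    gibbsEnergy c κ φ = ∑ y, φ y * massiveLaplacian c κ φ y := by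
  rw [sum_mul_massiveLaplacian hc, gibbsEnergy]
  simp only [sq]

lemma gibbsEnergy_add (hc : ∀ x y, c x y = c y x) (φ ψ : K → ℝ) :
    gibbsEnergy c κ (φ + ψ) = gibbsEnergy c κ φ + 2 * ∑ y, φ y * massiveLaplacian c κ ψ y
      + gibbsEnergy c κ ψ := by
  have hsymm : ∑ y, ψ y * massiveLaplacian c κ φ y = ∑ y, φ y * massiveLaplacian c κ ψ y := by
    simp only [sum_mul_massiveLaplacian hc, mul_comm]
  simp only [gibbsEnergy_eq_sum hc, map_add, Pi.add_apply, add_mul, mul_add,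
    Finset.sum_add_distrib, hsymm]
  ring

lemma le_gibbsEnergy (hc₀ : ∀ x y, 0 ≤ c x y) {θ : ℝ} (hκ : ∀ x, θ ≤ κ x) (φ : K → ℝ) :
    θ * ∑ x, φ x ^ 2 ≤ gibbsEnergy c κ φ := by
  have h₁ : 0 ≤ ∑ x, ∑ y, c x y * (φ y - φ x) ^ 2 :=
    Finset.sum_nonneg fun x _ => Finset.sum_nonneg fun y _ => mul_nonneg (hc₀ x y) (sq_nonneg _)
  have h₂ : θ * ∑ x, φ x ^ 2 ≤ ∑ x, κ x * φ x ^ 2 := by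
    rw [Finset.mul_sum]
    exact Finset.sum_le_sum fun x _ => mul_le_mul_of_nonneg_right (hκ x) (sq_nonneg _)
  rw [gibbsEnergy]
  linarith

lemma continuous_gibbsEnergy : Continuous (gibbsEnergy c κ) := by
  unfold gibbsEnergy
  fun_prop

lemma surjective_massiveLaplacian (hc : ∀ x y, c x y = c y x) (hc₀ : ∀ x y, 0 ≤ c x y)
    {θ : ℝ} (hθ : 0 < θ) (hκ : ∀ x, θ ≤ κ x) :
    Function.Surjective (massiveLaplacian c κ) := by
  rw [← LinearMap.injective_iff_surjective, injective_iff_map_eq_zero]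
  intro φ hφ
  have h := le_gibbsEnergy hc₀ hκ φ
  rw [gibbsEnergy_eq_sum hc, hφ] at h
  have h₀ : ∑ x, φ x ^ 2 ≤ 0 := by
    simp only [Pi.zero_apply, mul_zero, Finset.sum_const_zero] at h
    exact nonpos_of_mul_nonpos_right h hθ
  ext y
  have := (Finset.sum_eq_zero_iff_of_nonneg fun x _ => sq_nonneg (φ x)).1
    (h₀.antisymm (Finset.sum_nonneg fun x _ => sq_nonneg (φ x))) y (Finset.mem_univ y)
  simpa using this

/-- Minimum principle for the massive Laplacian. -/
lemma nonneg_of_massiveLaplacian_nonneg (hc₀ : ∀ x y, 0 ≤ c x y) (hκ : ∀ x, 0 < κ x)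
    {w : K → ℝ} (hw : ∀ y, 0 ≤ massiveLaplacian c κ w y) (y : K) : 0 ≤ w y := by
  obtain ⟨z, -, hz⟩ := Finset.exists_min_image Finset.univ w ⟨y, Finset.mem_univ y⟩
  refine le_trans ?_ (hz y (Finset.mem_univ y))
  by_contra! hneg
  have h₁ : ∑ u, c z u * (w z - w u) ≤ 0 := Finset.sum_nonpos fun u hu =>
    mul_nonpos_of_nonneg_of_nonpos (hc₀ z u) (sub_nonpos.2 (hz u hu))
  have h₂ := hw z
  rw [massiveLaplacian_apply] at h₂
  linarith [mul_neg_of_pos_of_neg (hκ z) hneg]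

/-- The Green function with pole at `x`: it is nonnegative, and translating the field along it
tilts the energy by a function of `φ x` only. -/
lemma exists_green (hc : ∀ x y, c x y = c y x) (hc₀ : ∀ x y, 0 ≤ c x y)
    {θ : ℝ} (hθ : 0 < θ) (hκ : ∀ x, θ ≤ κ x) (x : K) :
    ∃ w : K → ℝ, (∀ y, 0 ≤ w y) ∧ 0 < w x ∧ ∀ (t : ℝ) (φ : K → ℝ),
      gibbsEnergy c κ (φ + t • w) = gibbsEnergy c κ φ + 2 * t * φ x + t ^ 2 * w x := by
  classical
  obtain ⟨w, hw⟩ := surjective_massiveLaplacian hc hc₀ hθ hκ (Pi.single x 1)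
  have hw₀ : ∀ y, 0 ≤ w y := by
    refine nonneg_of_massiveLaplacian_nonneg hc₀ (fun y => hθ.trans_le (hκ y)) fun y => ?_
    rw [hw]
    exact (Pi.single_nonneg.2 zero_le_one : (0 : K → ℝ) ≤ Pi.single x 1) y
  refine ⟨w, hw₀, (hw₀ x).lt_of_ne fun h0 => ?_, fun t φ => ?_⟩
  · have h₁ := congrFun hw x
    rw [massiveLaplacian_apply, ← h0, Pi.single_eq_same] at h₁
    have h₂ : ∑ z, c x z * (0 - w z) ≤ 0 := Finset.sum_nonpos fun z _ =>
      mul_nonpos_of_nonneg_of_nonpos (hc₀ x z) (by linarith [hw₀ z])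
    linarith
  · rw [gibbsEnergy_add hc, gibbsEnergy_eq_sum hc (t • w), map_smul, hw]
    simp only [Pi.smul_apply, smul_eq_mul, Pi.single_apply, mul_ite, mul_one, mul_zero,
      Finset.sum_ite_eq', Finset.mem_univ, if_true]
    ring

lemma integrable_exp_neg_gibbsEnergy (hc₀ : ∀ x y, 0 ≤ c x y) {θ : ℝ} (hθ : 0 < θ)
    (hκ : ∀ x, θ ≤ κ x) :
    Integrable fun φ : K → ℝ => Real.exp (-(gibbsEnergy c κ φ) / 2) := by
  have hprod : Integrable fun φ : K → ℝ => ∏ x, Real.exp (-(θ / 2) * φ x ^ 2) :=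
    Integrable.fintype_prod fun _ => integrable_exp_neg_mul_sq (half_pos hθ)
  refine hprod.mono' ?_ (Filter.Eventually.of_forall fun φ => ?_)
  · have := continuous_gibbsEnergy (c := c) (κ := κ)
    exact Continuous.aestronglyMeasurable (by fun_prop)
  · rw [Real.norm_eq_abs, Real.abs_exp, ← Real.exp_sum, Real.exp_le_exp, ← Finset.mul_sum]
    linarith [le_gibbsEnergy hc₀ hκ φ]

end Energy

lemma MeasureTheory.MeasurePreserving.of_involutive_linearMap {V : Type*} [NormedAddCommGroup V]
    [NormedSpace ℝ V] [MeasurableSpace V] [BorelSpace V] [FiniteDimensional ℝ V] (ν : Measure V)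
    [ν.IsAddHaarMeasure] (f : V →ₗ[ℝ] V) (hf : f ∘ₗ f = LinearMap.id) :
    MeasurePreserving f ν ν := by
  refine ⟨f.continuous_of_finiteDimensional.measurable, ?_⟩
  have h : LinearMap.det f * LinearMap.det f = 1 := by
    rw [← LinearMap.det_comp, hf, LinearMap.det_id]
  have habs : |(LinearMap.det f)⁻¹| = 1 := by
    rcases mul_self_eq_one_iff.1 h with h | h <;> simp [h]
  rw [Measure.map_linearMap_addHaar_eq_smul_addHaar ν (left_ne_zero_of_mul_eq_one h), habs]
  simp

lemma MeasureTheory.MeasurePreserving.withDensity_of_comp_eq {α : Type*} [MeasurableSpace α]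
    {ν : Measure α} {f : α → α} (hf : MeasurePreserving f ν ν) {g : α → ENNReal}
    (hg : Measurable g) (hgf : ∀ a, g (f a) = g a) :
    MeasurePreserving f (ν.withDensity g) (ν.withDensity g) := by
  refine ⟨hf.measurable, Measure.ext fun s hs => ?_⟩
  rw [Measure.map_apply hf.measurable hs, withDensity_apply _ hs,
    withDensity_apply _ (hf.measurable hs), ← hf.setLIntegral_comp_preimage hs hg]
  simp only [hgf]

/-- The probability measure with density proportional to `exp (-E / 2)`. -/
noncomputable def gibbsMeasure {K : Type} [Fintype K] (E : (K → ℝ) → ℝ) : Measure (K → ℝ) :=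
  volume.withDensity fun φ =>
    ENNReal.ofReal (Real.exp (-(E φ) / 2) / ∫ φ, Real.exp (-(E φ) / 2))

/-- Exchange of the components of two fields along the direction `u`, as measured at `x`. -/
noncomputable def swapAlong {K : Type} (x : K) (u : K → ℝ) :
    (K → ℝ) × (K → ℝ) →ₗ[ℝ] (K → ℝ) × (K → ℝ) where
  toFun p := (p.1 + (p.2 x - p.1 x) • u, p.2 + (p.1 x - p.2 x) • u)
  map_add' p q := by
    ext y <;> simp only [Prod.fst_add, Prod.snd_add, Pi.add_apply, Pi.smul_apply, smul_eq_mul] <;>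
      ring
  map_smul' a p := by
    ext y <;> simp only [Prod.smul_fst, Prod.smul_snd, Pi.add_apply, Pi.smul_apply, smul_eq_mul,
      RingHom.id_apply] <;> ring

section Gibbs

variable {K : Type} [Fintype K] {E : (K → ℝ) → ℝ} {x : K} {w : K → ℝ}

lemma swapAlong_apply {K : Type} (x : K) (u : K → ℝ) (p : (K → ℝ) × (K → ℝ)) :
    swapAlong x u p = (p.1 + (p.2 x - p.1 x) • u, p.2 + (p.1 x - p.2 x) • u) := rfl

lemma swapAlong_comp_self {K : Type} {x : K} {u : K → ℝ} (hu : u x = 1) :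
    swapAlong x u ∘ₗ swapAlong x u = LinearMap.id := by
  refine LinearMap.ext fun p => ?_
  ext y <;> simp only [LinearMap.comp_apply, swapAlong_apply, Pi.add_apply, Pi.smul_apply,
    smul_eq_mul, hu, LinearMap.id_apply] <;> ring

lemma measurable_gibbsDensity (hE : Continuous E) : Measurable fun φ =>
    ENNReal.ofReal (Real.exp (-(E φ) / 2) / ∫ φ, Real.exp (-(E φ) / 2)) := by
  have := hE.measurable
  fun_prop

lemma integral_exp_neg_energy_pos (hint : Integrable fun φ => Real.exp (-(E φ) / 2)) :
    0 < ∫ φ, Real.exp (-(E φ) / 2) :=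
  integral_exp_pos hint

lemma isProbabilityMeasure_gibbsMeasure
    (hint : Integrable fun φ => Real.exp (-(E φ) / 2)) :
    IsProbabilityMeasure (gibbsMeasure E) := by
  have hZ := integral_exp_neg_energy_pos hint
  constructor
  rw [gibbsMeasure, withDensity_apply _ MeasurableSet.univ, Measure.restrict_univ,
    ← ofReal_integral_eq_lintegral_ofReal (hint.div_const _)
      (Filter.Eventually.of_forall fun φ => by positivity), integral_div, div_self hZ.ne',
    ENNReal.ofReal_one]

lemma mgf_gibbsMeasure (hE : Continuous E) (hint : Integrable fun φ => Real.exp (-(E φ) / 2))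
    (hw : ∀ (t : ℝ) (φ : K → ℝ), E (φ + t • w) = E φ + 2 * t * φ x + t ^ 2 * w x) (t : ℝ) :
    ProbabilityTheory.mgf (fun φ => φ x) (gibbsMeasure E) t = Real.exp (w x * t ^ 2 / 2) := by
  have hZ := integral_exp_neg_energy_pos hint
  rw [ProbabilityTheory.mgf, gibbsMeasure, integral_withDensity_eq_integral_toReal_smul
    (measurable_gibbsDensity hE) (Filter.Eventually.of_forall fun φ => ENNReal.ofReal_lt_top),
    ← integral_add_right_eq_self _ (t • w)]
  have : ∀ φ : K → ℝ, (ENNReal.ofReal (Real.exp (-(E (φ + t • w)) / 2) /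
      ∫ φ, Real.exp (-(E φ) / 2))).toReal • Real.exp (t * (φ + t • w) x) =
      Real.exp (-(E φ) / 2) * (Real.exp (w x * t ^ 2 / 2) / ∫ φ, Real.exp (-(E φ) / 2)) := by
    intro φ
    rw [ENNReal.toReal_ofReal (by positivity), smul_eq_mul, div_mul_eq_mul_div, ← Real.exp_add,
      ← mul_div_assoc, ← Real.exp_add, hw, Pi.add_apply, Pi.smul_apply, smul_eq_mul]
    ring_nf
  simp only [this]
  rw [integral_mul_const, mul_div_cancel₀ _ hZ.ne']

/-- The law of `φ x` under the Gibbs measure is centred Gaussian with variance the Green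
function at `x`. -/
lemma map_eval_gibbsMeasure (hE : Continuous E)
    (hint : Integrable fun φ => Real.exp (-(E φ) / 2)) (hwx : 0 < w x)
    (hw : ∀ (t : ℝ) (φ : K → ℝ), E (φ + t • w) = E φ + 2 * t * φ x + t ^ 2 * w x) :
    (gibbsMeasure E).map (fun φ => φ x) = ProbabilityTheory.gaussianReal 0 (w x).toNNReal := by
  have := isProbabilityMeasure_gibbsMeasure hint
  have hmgf : ProbabilityTheory.mgf (fun φ => φ x) (gibbsMeasure E) =
      ProbabilityTheory.mgf id (ProbabilityTheory.gaussianReal 0 (w x).toNNReal) := by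
    funext t
    simp only [mgf_gibbsMeasure hE hint hw, ProbabilityTheory.mgf_id_gaussianReal,
      Real.coe_toNNReal _ hwx.le, zero_mul, zero_add]
  have hset : ProbabilityTheory.integrableExpSet (fun φ : K → ℝ => φ x) (gibbsMeasure E)
      = Set.univ := by
    refine Set.eq_univ_of_forall fun t => ?_
    refine ProbabilityTheory.mgf_pos_iff.1 ?_
    rw [mgf_gibbsMeasure hE hint hw]
    positivity
  have h := Measure.ext_of_complexMGF_eq (μ := gibbsMeasure E)
    (μ' := ProbabilityTheory.gaussianReal 0 (w x).toNNReal) (X := fun φ => φ x) (Y := id)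
    (measurable_pi_apply x).aemeasurable aemeasurable_id (funext fun z =>
      ProbabilityTheory.eqOn_complexMGF_of_mgf hmgf (by simp [hset]))
  rwa [Measure.map_id] at h

lemma measurePreserving_swapAlong (hE : Continuous E)
    (hint : Integrable fun φ => Real.exp (-(E φ) / 2)) (hwx : 0 < w x)
    (hw : ∀ (t : ℝ) (φ : K → ℝ), E (φ + t • w) = E φ + 2 * t * φ x + t ^ 2 * w x) :
    MeasurePreserving (swapAlong x ((w x)⁻¹ • w)) ((gibbsMeasure E).prod (gibbsMeasure E))
      ((gibbsMeasure E).prod (gibbsMeasure E)) := by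
  have hm := measurable_gibbsDensity hE
  have hZ := integral_exp_neg_energy_pos hint
  rw [gibbsMeasure, prod_withDensity hm hm]
  have : (volume.prod volume : Measure ((K → ℝ) × (K → ℝ))).IsAddHaarMeasure :=
    Measure.prod.instIsAddHaarMeasure _ _
  refine (MeasurePreserving.of_involutive_linearMap _ _
    (swapAlong_comp_self (by simp [hwx.ne']))).withDensity_of_comp_eq (by fun_prop) fun p => ?_
  rw [← ENNReal.ofReal_mul (by positivity), ← ENNReal.ofReal_mul (by positivity),
    div_mul_div_comm, div_mul_div_comm, ← Real.exp_add, ← Real.exp_add, swapAlong_apply]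
  simp only [smul_smul, hw]
  congr 3
  field_simp
  ring

/-- Chebyshev's association inequality: given `φ x ∈ s`, the indicator of an event that is stable
under translation by positive multiples of `w` is positively correlated with `φ x`. -/
lemma measureReal_mul_setIntegral_le (hE : Continuous E)
    (hint : Integrable fun φ => Real.exp (-(E φ) / 2)) (hwx : 0 < w x)
    (hw : ∀ (t : ℝ) (φ : K → ℝ), E (φ + t • w) = E φ + 2 * t * φ x + t ^ 2 * w x)
    (hintx : Integrable (fun φ : K → ℝ => φ x) (gibbsMeasure E))
    {B : Set (K → ℝ)} (hB : MeasurableSet B) (hBw : ∀ φ ∈ B, ∀ t : ℝ, 0 ≤ t → φ + t • w ∈ B)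
    {s : Set ℝ} (hs : MeasurableSet s) :
    (gibbsMeasure E).real (B ∩ {φ | φ x ∈ s}) * ∫ φ in {φ | φ x ∈ s}, φ x ∂gibbsMeasure E ≤
      (gibbsMeasure E).real {φ | φ x ∈ s} *
        ∫ φ in B ∩ {φ | φ x ∈ s}, φ x ∂gibbsMeasure E := by
  have := isProbabilityMeasure_gibbsMeasure hint
  set μ := gibbsMeasure E
  set S : Set (K → ℝ) := {φ | φ x ∈ s}
  have hS : MeasurableSet S := hs.preimage (measurable_pi_apply x)
  let b : (K → ℝ) → ℝ := (B ∩ S).indicator 1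
  let a : (K → ℝ) → ℝ := S.indicator 1
  let bx : (K → ℝ) → ℝ := (B ∩ S).indicator fun φ => φ x
  let ax : (K → ℝ) → ℝ := S.indicator fun φ => φ x
  have hb : Integrable b μ := (integrable_const 1).indicator (hB.inter hS)
  have ha : Integrable a μ := (integrable_const 1).indicator hS
  have hbx : Integrable bx μ := hintx.indicator (hB.inter hS)
  have hax : Integrable ax μ := hintx.indicator hS
  let g : (K → ℝ) × (K → ℝ) → ℝ := fun p => bx p.1 * a p.2 - b p.1 * ax p.2
  have hg : Integrable g (μ.prod μ) := (hbx.mul_prod ha).sub (hb.mul_prod hax)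
  have hgval : ∫ p, g p ∂μ.prod μ =
      μ.real S * (∫ φ in B ∩ S, φ x ∂μ) - μ.real (B ∩ S) * ∫ φ in S, φ x ∂μ := by
    rw [integral_sub (hbx.mul_prod ha) (hb.mul_prod hax), integral_prod_mul, integral_prod_mul,
      integral_indicator_one (hB.inter hS), integral_indicator_one hS,
      integral_indicator (hB.inter hS), integral_indicator hS]
    ring
  have hR := measurePreserving_swapAlong hE hint hwx hw
  have hgR : ∫ p, g (swapAlong x ((w x)⁻¹ • w) p) ∂μ.prod μ = ∫ p, g p ∂μ.prod μ := by
    conv_rhs => rw [← hR.map_eq]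
    rw [integral_map hR.aemeasurable (by rw [hR.map_eq]; exact hg.aestronglyMeasurable)]
  have hnonneg : 0 ≤ ∫ p, (g p + g (swapAlong x ((w x)⁻¹ • w) p)) ∂μ.prod μ := by
    refine integral_nonneg fun p => ?_
    obtain ⟨φ, ψ⟩ := p
    have hφ : (φ + (ψ x - φ x) • (w x)⁻¹ • w) x = ψ x := by simp [hwx.ne']
    have hψ : (ψ + (φ x - ψ x) • (w x)⁻¹ • w) x = φ x := by simp [hwx.ne']
    by_cases hφs : φ x ∈ s
    swap
    · simp [g, a, b, ax, bx, S, swapAlong_apply, hφs, hwx.ne']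
    by_cases hψs : ψ x ∈ s
    swap
    · simp [g, a, b, ax, bx, S, swapAlong_apply, hψs, hwx.ne']
    set φ' := φ + (ψ x - φ x) • (w x)⁻¹ • w with hφ'
    set ψ' := ψ + (φ x - ψ x) • (w x)⁻¹ • w
    have hw₀ := inv_pos.2 hwx
    have h₁ : φ x ≤ ψ x → φ ∈ B → φ' ∈ B := fun hle hm => by
      rw [hφ', smul_smul]
      exact hBw φ hm _ (mul_nonneg (sub_nonneg.2 hle) hw₀.le)
    have h₂ : ψ x ≤ φ x → φ' ∈ B → φ ∈ B := fun hle hm => by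
      have := hBw φ' hm ((φ x - ψ x) * (w x)⁻¹) (mul_nonneg (sub_nonneg.2 hle) hw₀.le)
      rwa [hφ', smul_smul, add_assoc, ← add_smul, ← add_mul, sub_add_sub_cancel', sub_self,
        zero_mul, zero_smul, add_zero] at this
    have hφS : φ ∈ S := hφs
    have hψS : ψ ∈ S := hψs
    have hφS' : φ' ∈ S := by simpa [S, hφ] using hψs
    have hψS' : ψ' ∈ S := by simpa [S, hψ] using hφs
    by_cases m : φ ∈ B <;> by_cases m' : φ' ∈ B <;>
      simp only [g, a, b, ax, bx, swapAlong_apply, Set.indicator, Set.mem_inter_iff, hφS, hψS,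
        hφS', hψS', m, m', hφ, hψ, Pi.zero_apply, if_true, if_false, Pi.one_apply, and_true,
        show φ + (ψ x - φ x) • (w x)⁻¹ • w = φ' from rfl,
        show ψ + (φ x - ψ x) • (w x)⁻¹ • w = ψ' from rfl]
    · simp
    · have : ψ x ≤ φ x := le_of_not_ge fun hle => m' (h₁ hle m)
      simpa using this
    · have : φ x ≤ ψ x := le_of_not_ge fun hle => m (h₂ hle m')
      simpa using this
    · simp
  have hgR' : Integrable (fun p => g (swapAlong x ((w x)⁻¹ • w) p)) (μ.prod μ) :=
    hR.integrable_comp_of_integrable hg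
  rw [integral_add hg hgR', hgR, hgval] at hnonneg
  linarith

end Gibbs

section Gaussian

open ProbabilityTheory

lemma le_gaussianPDFReal {v v₀ v₁ : ℝ} (hv₀ : 0 < v₀) (h₀ : v₀ ≤ v) (h₁ : v ≤ v₁) {R t : ℝ}
    (ht : t ^ 2 ≤ R ^ 2) :
    (√(2 * π * v₁))⁻¹ * Real.exp (-R ^ 2 / (2 * v₀)) ≤ gaussianPDFReal 0 v.toNNReal t := by
  have hv : 0 < v := hv₀.trans_le h₀
  simp only [gaussianPDFReal_def, Real.coe_toNNReal _ hv.le, sub_zero, neg_div]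
  gcongr

lemma le_gaussianReal_real_Icc {v v₀ v₁ : ℝ} (hv₀ : 0 < v₀) (h₀ : v₀ ≤ v) (h₁ : v ≤ v₁)
    {R a : ℝ} (ha : ∀ t ∈ Set.Icc a (a + 1), t ^ 2 ≤ R ^ 2) :
    (√(2 * π * v₁))⁻¹ * Real.exp (-R ^ 2 / (2 * v₀)) ≤
      (gaussianReal 0 v.toNNReal).real (Set.Icc a (a + 1)) := by
  have hv : 0 < v := hv₀.trans_le h₀
  rw [measureReal_def, gaussianReal_apply_eq_integral _ (by simpa using hv), ENNReal.toReal_ofReal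
    (integral_nonneg fun t => gaussianPDFReal_nonneg _ _ _)]
  have := setIntegral_ge_of_const_le_real (μ := volume) (measurableSet_Icc (a := a) (b := a + 1))
    (by simp) (fun t ht => le_gaussianPDFReal hv₀ h₀ h₁ (ha t ht))
    (integrable_gaussianPDFReal _ _).integrableOn
  simpa [measureReal_def] using this

/-- Lower bound on a truncated first moment of a centred Gaussian, uniform in the variance and the
truncation level. -/
lemma le_setIntegral_Ici_gaussianReal {v v₀ v₁ M h : ℝ} (hv₀ : 0 < v₀) (h₀ : v₀ ≤ v)
    (h₁ : v ≤ v₁) (hM : 0 < M) (hh : h ∈ Set.Ioo (-M) M) :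
    M * ((√(2 * π * v₁))⁻¹ * Real.exp (-(M + 1) ^ 2 / (2 * v₀))) ≤
      ∫ t in Set.Ici h, t ∂gaussianReal 0 v.toNNReal := by
  set γ := gaussianReal 0 v.toNNReal
  have hint : Integrable (fun t : ℝ => t) γ := memLp_one_iff_integrable.1 (memLp_id_gaussianReal 1)
  rcases le_or_gt 0 h with h0 | h0
  · calc
      _ ≤ M * γ.real (Set.Icc M (M + 1)) := by
        gcongr
        refine le_gaussianReal_real_Icc hv₀ h₀ h₁ fun t ht => ?_
        exact pow_le_pow_left₀ (hM.le.trans ht.1) ht.2 2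
      _ ≤ ∫ t in Set.Icc M (M + 1), t ∂γ :=
        setIntegral_ge_of_const_le_real measurableSet_Icc (measure_ne_top _ _) (fun t ht => ht.1)
          hint.integrableOn
      _ ≤ _ := by
        refine setIntegral_mono_set hint.integrableOn ?_
          (Filter.Eventually.of_forall fun t ht => hh.2.le.trans ht.1)
        exact (ae_restrict_iff' measurableSet_Ici).2
          (Filter.Eventually.of_forall fun t ht => h0.trans ht)
  · have hsplit : ∫ t in Set.Ici h, t ∂γ = ∫ t in Set.Iio h, -t ∂γ := by
      have := integral_add_compl (measurableSet_Ici (a := h)) hint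
      rw [Set.compl_Ici, integral_id_gaussianReal] at this
      rw [integral_neg]
      linarith
    have key : ∀ t ∈ Set.Icc (-M - 1) (-M - 1 + 1), t ≤ -M := fun t ht => by linarith [ht.2]
    rw [hsplit]
    calc
      _ ≤ M * γ.real (Set.Icc (-M - 1) (-M - 1 + 1)) := by
        gcongr
        refine le_gaussianReal_real_Icc hv₀ h₀ h₁ fun t ht => ?_
        rw [← neg_sq t]
        exact pow_le_pow_left₀ (by linarith [key t ht]) (by linarith [ht.1]) 2
      _ ≤ ∫ t in Set.Icc (-M - 1) (-M - 1 + 1), -t ∂γ :=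
        setIntegral_ge_of_const_le_real measurableSet_Icc (measure_ne_top _ _)
          (fun t ht => by linarith [key t ht]) hint.neg.integrableOn
      _ ≤ _ := by
        refine setIntegral_mono_set hint.neg.integrableOn ?_
          (Filter.Eventually.of_forall fun t ht => (key t ht).trans_lt hh.1)
        exact (ae_restrict_iff' measurableSet_Iio).2
          (Filter.Eventually.of_forall fun t ht => by
            have : t < h := ht
            simp only [Pi.zero_apply]
            linarith)

end Gaussian

lemma measurableSet_levSet {K : Type} [Finite K] (A : Set (K → Bool)) (h : ℝ) :
    MeasurableSet (levSet A h) := by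
  have hm : Measurable fun (φ : K → ℝ) (x : K) => decide (h ≤ φ x) :=
    measurable_pi_lambda _ fun x => measurable_to_bool (by
      simpa [Set.preimage] using measurableSet_le measurable_const (measurable_pi_apply x))
  exact hm A.toFinite.measurableSet

lemma add_mem_levSet {K : Type} {A : Set (K → Bool)}
    (hA : ∀ ω ω' : K → Bool, ω ∈ A → (∀ y, ω y ≤ ω' y) → ω' ∈ A) {h : ℝ} {φ ψ : K → ℝ}
    (hφ : φ ∈ levSet A h) (hψ : ∀ y, 0 ≤ ψ y) : φ + ψ ∈ levSet A h := by
  refine hA _ _ hφ fun y => ?_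
  rw [Bool.le_iff_imp]
  simp only [decide_eq_true_eq, Pi.add_apply]
  exact fun hy => hy.trans (le_add_of_nonneg_right (hψ y))

lemma div_mul_le_of_mul_le_mul {p q a b : ℝ} (hp : 0 < p) (h : q * a ≤ p * b) :
    q / p * a ≤ b := by
  rwa [div_mul_eq_mul_div, div_le_iff₀ hp, mul_comm b]

section Domination

variable {K : Type} [Fintype K] {E : (K → ℝ) → ℝ} {x : K} {w : K → ℝ}

lemma integrable_eval_gibbsMeasure (hE : Continuous E)
    (hint : Integrable fun φ => Real.exp (-(E φ) / 2)) (hwx : 0 < w x)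
    (hw : ∀ (t : ℝ) (φ : K → ℝ), E (φ + t • w) = E φ + 2 * t * φ x + t ^ 2 * w x) :
    Integrable (fun φ : K → ℝ => φ x) (gibbsMeasure E) := by
  have h : Integrable id ((gibbsMeasure E).map fun φ => φ x) := by
    rw [map_eval_gibbsMeasure hE hint hwx hw]
    exact memLp_one_iff_integrable.1 (ProbabilityTheory.memLp_id_gaussianReal 1)
  exact h.comp_measurable (measurable_pi_apply x)

lemma integral_eval_gibbsMeasure (hE : Continuous E)
    (hint : Integrable fun φ => Real.exp (-(E φ) / 2)) (hwx : 0 < w x)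
    (hw : ∀ (t : ℝ) (φ : K → ℝ), E (φ + t • w) = E φ + 2 * t * φ x + t ^ 2 * w x) :
    ∫ φ, φ x ∂gibbsMeasure E = 0 := by
  rw [← integral_map (φ := fun φ : K → ℝ => φ x) (f := fun t : ℝ => t)
    (measurable_pi_apply x).aemeasurable (by fun_prop), map_eval_gibbsMeasure hE hint hwx hw,
    ProbabilityTheory.integral_id_gaussianReal]

lemma integral_sq_eval_gibbsMeasure (hE : Continuous E)
    (hint : Integrable fun φ => Real.exp (-(E φ) / 2)) (hwx : 0 < w x)
    (hw : ∀ (t : ℝ) (φ : K → ℝ), E (φ + t • w) = E φ + 2 * t * φ x + t ^ 2 * w x) :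
    ∫ φ, φ x ^ 2 ∂gibbsMeasure E = w x := by
  have h := ProbabilityTheory.variance_id_gaussianReal (μ := 0) (v := (w x).toNNReal)
  rw [ProbabilityTheory.variance_eq_integral aemeasurable_id] at h
  simp only [id, ProbabilityTheory.integral_id_gaussianReal, sub_zero,
    Real.coe_toNNReal _ hwx.le] at h
  rw [← integral_map (φ := fun φ : K → ℝ => φ x) (f := fun t : ℝ => t ^ 2)
    (measurable_pi_apply x).aemeasurable (by fun_prop), map_eval_gibbsMeasure hE hint hwx hw, h]

lemma setIntegral_mul_condInfl_le (hE : Continuous E)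
    (hint : Integrable fun φ => Real.exp (-(E φ) / 2)) (hwx : 0 < w x) (hw₀ : ∀ y, 0 ≤ w y)
    (hw : ∀ (t : ℝ) (φ : K → ℝ), E (φ + t • w) = E φ + 2 * t * φ x + t ^ 2 * w x)
    {A : Set (K → Bool)}
    (hA : ∀ ω ω' : K → Bool, ω ∈ A → (∀ y, ω y ≤ ω' y) → ω' ∈ A) {h : ℝ}
    (hm : 0 < ∫ φ in {φ | h ≤ φ x}, φ x ∂gibbsMeasure E) :
    (∫ φ in {φ | h ≤ φ x}, φ x ∂gibbsMeasure E) * condInfl (gibbsMeasure E) A h x ≤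
      ∫ φ in levSet A h, φ x ∂gibbsMeasure E := by
  have := isProbabilityMeasure_gibbsMeasure hint
  have hintx := integrable_eval_gibbsMeasure hE hint hwx hw
  have hmean := integral_eval_gibbsMeasure hE hint hwx hw
  have hB := measurableSet_levSet A h
  have hBw : ∀ φ ∈ levSet A h, ∀ t : ℝ, 0 ≤ t → φ + t • w ∈ levSet A h := fun φ hφ t ht =>
    add_mem_levSet hA hφ fun y => mul_nonneg ht (hw₀ y)
  have hup := measureReal_mul_setIntegral_le hE hint hwx hw hintx hB hBw
    (measurableSet_Ici (a := h))
  have hlow := measureReal_mul_setIntegral_le hE hint hwx hw hintx hB hBw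
    (measurableSet_Iio (a := h))
  simp only [Set.mem_Ici, Set.mem_Iio] at hup hlow
  have hU : MeasurableSet {φ : K → ℝ | h ≤ φ x} :=
    measurableSet_le measurable_const (measurable_pi_apply x)
  have hcompl : {φ : K → ℝ | h ≤ φ x}ᶜ = {φ | φ x < h} := by
    ext φ
    simp
  have hneg : ∫ φ in {φ | φ x < h}, φ x ∂gibbsMeasure E =
      -∫ φ in {φ | h ≤ φ x}, φ x ∂gibbsMeasure E := by
    have := integral_add_compl hU hintx
    rw [hcompl, hmean] at this
    linarith
  have hpos : ∀ s : Set (K → ℝ), ∫ φ in s, φ x ∂gibbsMeasure E ≠ 0 →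
      0 < (gibbsMeasure E).real s := fun s hs =>
    measureReal_nonneg.lt_of_ne fun h0 => hs (setIntegral_measure_zero _
      ((measureReal_eq_zero_iff).1 h0.symm))
  have hsplit := integral_inter_add_sdiff hU (hintx.integrableOn (s := levSet A h))
  rw [Set.sdiff_eq, hcompl] at hsplit
  have h₁ := div_mul_le_of_mul_le_mul (hpos _ hm.ne') hup
  have h₂ := div_mul_le_of_mul_le_mul (hpos _ (by rw [hneg]; linarith)) hlow
  rw [hneg] at h₂
  simp only [measureReal_def] at h₁ h₂
  rw [condInfl]
  linarith

lemma setIntegral_levSet_nonneg (hE : Continuous E)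
    (hint : Integrable fun φ => Real.exp (-(E φ) / 2)) (hwx : 0 < w x) (hw₀ : ∀ y, 0 ≤ w y)
    (hw : ∀ (t : ℝ) (φ : K → ℝ), E (φ + t • w) = E φ + 2 * t * φ x + t ^ 2 * w x)
    {A : Set (K → Bool)}
    (hA : ∀ ω ω' : K → Bool, ω ∈ A → (∀ y, ω y ≤ ω' y) → ω' ∈ A) (h : ℝ) :
    0 ≤ ∫ φ in levSet A h, φ x ∂gibbsMeasure E := by
  have := isProbabilityMeasure_gibbsMeasure hint
  have key := measureReal_mul_setIntegral_le hE hint hwx hw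
    (integrable_eval_gibbsMeasure hE hint hwx hw) (measurableSet_levSet A h)
    (fun φ hφ t ht => add_mem_levSet hA hφ fun y => mul_nonneg ht (hw₀ y)) MeasurableSet.univ
  simpa [integral_eval_gibbsMeasure hE hint hwx hw] using key

end Domination

/-- **Pointwise domination of the conditional influence** (Proposition 4.3, eq. (4.7)):
for κ ≥ θ and uniformly bounded variances, `∫_{A^h} κ x · φ x dμ ≥ c · I_μ(A^h, x)`,
with `c = c(θ, M, v₀, v₁) > 0`. -/
theorem pointwise_domination_of_influence
    (θ M v₀ v₁ : ℝ) (hθ : θ ∈ Set.Ioo (0 : ℝ) 1) (hM : 0 < M)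
    (hv₀ : 0 < v₀) (hv : v₀ ≤ v₁) :
    ∃ c₁ : ℝ, 0 < c₁ ∧
      ∀ (K : Type) [Fintype K] [Nonempty K]
        (c : K → K → ℝ), (∀ x y, c x y = c y x) → (∀ x y, 0 ≤ c x y) →
        ∀ κ : K → ℝ, (∀ x, θ ≤ κ x) →
        ∀ E : (K → ℝ) → ℝ,
          (∀ φ : K → ℝ,
            E φ = (1 / 2) * ∑ x, ∑ y, c x y * (φ y - φ x) ^ 2 + ∑ x, κ x * (φ x) ^ 2) →
        ∀ Z : ℝ, Z = (∫ φ : K → ℝ, Real.exp (-(E φ) / 2)) →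
        ∀ μ : Measure (K → ℝ),
          μ = volume.withDensity (fun φ => ENNReal.ofReal (Real.exp (-(E φ) / 2) / Z)) →
        ∀ x : K, v₀ ≤ (∫ φ : K → ℝ, (φ x) ^ 2 ∂μ) → (∫ φ : K → ℝ, (φ x) ^ 2 ∂μ) ≤ v₁ →
        ∀ A : Set (K → Bool),
          (∀ ω ω' : K → Bool, ω ∈ A → (∀ y, ω y ≤ ω' y) → ω' ∈ A) →
        ∀ h : ℝ, h ∈ Set.Ioo (-M) M →
          c₁ * condInfl μ A h x ≤ ∫ φ in levSet A h, κ x * φ x ∂μ := by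
  refine ⟨θ * (M * ((√(2 * π * v₁))⁻¹ * Real.exp (-(M + 1) ^ 2 / (2 * v₀)))), ?_, ?_⟩
  · have := hθ.1
    have := hv₀.trans_le hv
    positivity
  intro K _ _ c hc hc₀ κ hκ E hE Z hZ μ hμ x hx₀ hx₁ A hA h hh
  obtain rfl : E = gibbsEnergy c κ := funext hE
  obtain rfl : μ = gibbsMeasure (gibbsEnergy c κ) := by rw [hμ, hZ, gibbsMeasure]
  obtain ⟨w, hw₀, hwx, hw⟩ := exists_green hc hc₀ hθ.1 hκ x
  have hcont := continuous_gibbsEnergy (c := c) (κ := κ)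
  have hint := integrable_exp_neg_gibbsEnergy hc₀ hθ.1 hκ
  rw [integral_sq_eval_gibbsMeasure hcont hint hwx hw] at hx₀ hx₁
  have hm := le_setIntegral_Ici_gaussianReal hv₀ hx₀ hx₁ hM hh
  rw [← map_eval_gibbsMeasure hcont hint hwx hw, setIntegral_map measurableSet_Ici (by fun_prop)
    (measurable_pi_apply x).aemeasurable] at hm
  change _ ≤ ∫ φ in {φ : K → ℝ | h ≤ φ x}, φ x ∂gibbsMeasure (gibbsEnergy c κ) at hm
  set δ := M * ((√(2 * π * v₁))⁻¹ * Real.exp (-(M + 1) ^ 2 / (2 * v₀))) with hδ_def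
  have hδ : 0 < δ := by
    have := hv₀.trans_le hv
    positivity
  have hdom := setIntegral_mul_condInfl_le hcont hint hwx hw₀ hw hA (hδ.trans_le hm)
  have hnonneg := setIntegral_levSet_nonneg hcont hint hwx hw₀ hw hA h
  rw [integral_const_mul]
  calc θ * δ * condInfl _ A h x = θ * (δ * condInfl _ A h x) := mul_assoc _ _ _
    _ ≤ θ * ∫ φ in levSet A h, φ x ∂gibbsMeasure (gibbsEnergy c κ) := by
      refine mul_le_mul_of_nonneg_left ?_ hθ.1.le
      rcases le_total 0 (condInfl (gibbsMeasure (gibbsEnergy c κ)) A h x) with hI | hI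
      · exact (mul_le_mul_of_nonneg_right hm hI).trans hdom
      · exact (mul_nonpos_of_nonneg_of_nonpos hδ.le hI).trans hnonneg
    _ ≤ _ := mul_le_mul_of_nonneg_right (hκ x) hnonneg
end
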